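/- For every N ≥ 2, every integer r ≥ 0, and every polynomial f ∈ F[z_1,…,z_N] symmetric in all N variables: [ D_N^r , D_{1,{1,…,N}} ] f = β D_{1,{1,…,N−1}} ( Σ_{i=1}^{N−1} D_i^r − (N−1) D_N^r ) f. -/

import Mathlib

open MvPolynomial Finset

section CSDefs

variable {F : Type*} [Field F] [CharZero F]

/-- Exact division in a polynomial ring: `divExact d f = f / d` when `d ∣ f`, junk otherwise. -/
noncomputable def divExact {σ : Type*} (d f : MvPolynomial σ F) : MvPolynomial σ F := by
  classical exact if h : ∃ c, f = d * c then h.choose else 0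

/-- The exchange operator `K_{ij}` permuting the variables `z_i` and `z_j`. -/
noncomputable def Kswap {N : ℕ} (i j : Fin N) (f : MvPolynomial (Fin N) F) :
    MvPolynomial (Fin N) F :=
  rename (Equiv.swap i j) f

/-- The Dunkl operator `∇_i = ∂_i + β ∑_{j ≠ i} (z_i - z_j)⁻¹ (1 - K_{ij})`. -/
noncomputable def nabla {N : ℕ} (β : F) (i : Fin N) (f : MvPolynomial (Fin N) F) :
    MvPolynomial (Fin N) F :=
  pderiv i f + β • ∑ j ∈ Finset.univ.erase i, divExact (X i - X j) (f - Kswap i j f)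

/-- `D_i = z_i ∇_i`. -/
noncomputable def Dop {N : ℕ} (β : F) (i : Fin N) (f : MvPolynomial (Fin N) F) :
    MvPolynomial (Fin N) F :=
  X i * nabla β i f

/-- `(D_{j₁} + kβ)(D_{j₂} + (k+1)β) ⋯` applied along a list of indices. -/
noncomputable def Dlist {N : ℕ} (β : F) :
    ℕ → List (Fin N) → MvPolynomial (Fin N) F → MvPolynomial (Fin N) F
  | _, [], f => f
  | k, j :: rest, f => Dop β j (Dlist β (k + 1) rest f) + ((k : F) * β) • Dlist β (k + 1) rest f

/-- `D_{k,J} = (D_{j₁} + kβ)(D_{j₂} + (k+1)β) ⋯ (D_{j_ℓ} + (k+ℓ-1)β)` for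
`J = {j₁ < j₂ < … < j_ℓ}`. -/
noncomputable def DJ {N : ℕ} (β : F) (k : ℕ) (J : Finset (Fin N))
    (f : MvPolynomial (Fin N) F) : MvPolynomial (Fin N) F :=
  Dlist β k (J.sort (· ≤ ·)) f

/-- `z_J = ∏_{i ∈ J} z_i`. -/
noncomputable def zJ {N : ℕ} (J : Finset (Fin N)) : MvPolynomial (Fin N) F := ∏ i ∈ J, X i

/-- The creation operator `B⁺_{i,J} = ∑_{J' ⊆ J, |J'| = i} z_{J'} D_{1,J'}`. -/
noncomputable def Bplus {N : ℕ} (β : F) (i : ℕ) (J : Finset (Fin N))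
    (f : MvPolynomial (Fin N) F) : MvPolynomial (Fin N) F :=
  ∑ J' ∈ J.powersetCard i, zJ J' * DJ β 1 J' f

/-- `A_{ij} = ((z_i+z_j)/(z_i-z_j))(z_i ∂_i - z_j ∂_j)`. -/
noncomputable def Aop {N : ℕ} (i j : Fin N) (f : MvPolynomial (Fin N) F) :
    MvPolynomial (Fin N) F :=
  divExact (X i - X j) ((X i + X j) * (X i * pderiv i f - X j * pderiv j f))

/-- `H^{(S)} = ∑_{i ∈ S} (z_i ∂_i)² + β ∑_{i<j, i,j ∈ S} A_{ij}`. -/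
noncomputable def Hop {N : ℕ} (β : F) (S : Finset (Fin N)) (f : MvPolynomial (Fin N) F) :
    MvPolynomial (Fin N) F :=
  ∑ i ∈ S, X i * pderiv i (X i * pderiv i f)
    + β • ∑ i ∈ S, ∑ j ∈ S.filter (fun j => i < j), Aop i j f

/-- A polynomial is symmetric in the variables indexed by `S`. -/
def SymmOn {N : ℕ} (S : Finset (Fin N)) (f : MvPolynomial (Fin N) F) : Prop :=
  ∀ i ∈ S, ∀ j ∈ S, rename (Equiv.swap i j) f = f

/-- `phiCS β N lam i = (B⁺_i)^{λ_i - λ_{i+1}} ⋯ (B⁺_1)^{λ_1 - λ_2} · 1`,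
where `lam` is 0-indexed: `lam (j-1) = λ_j`. -/
noncomputable def phiCS (β : F) (N : ℕ) (lam : ℕ → ℕ) : ℕ → MvPolynomial (Fin N) F
  | 0 => 1
  | i + 1 => (fun f => Bplus β (i + 1) Finset.univ f)^[lam i - lam (i + 1)] (phiCS β N lam i)

/-- The monomial symmetric polynomial attached to an exponent vector. -/
noncomputable def msym (N : ℕ) (lam : Fin N → ℕ) : MvPolynomial (Fin N) F := by
  classical
  exact ∑ v ∈ (Finset.univ : Finset (Equiv.Perm (Fin N))).image
      (fun σ => fun i => lam (σ i)), ∏ i, X i ^ v i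

/-- `𝐷̂_i = D_i + β(i-1) - β ∑_{j<i} (1 - K_{ij})` (0-indexed: `i-1` becomes `i`). -/
noncomputable def Dhat {N : ℕ} (β : F) (i : Fin N) (f : MvPolynomial (Fin N) F) :
    MvPolynomial (Fin N) F :=
  Dop β i f + (β * ((i : ℕ) : F)) • f
    - β • ∑ j ∈ Finset.univ.filter (fun j => j < i), (f - Kswap i j f)

end CSDefs

section DunklRelations

variable {F : Type*} [Field F]

lemma divExact_spec {σ : Type*} {d f : MvPolynomial σ F} (h : d ∣ f) : d * divExact d f = f := by
  have h' : ∃ c, f = d * c := h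
  rw [divExact, dif_pos h']
  exact h'.choose_spec.symm

lemma X_sub_X_ne_zero {N : ℕ} {i j : Fin N} (h : i ≠ j) :
    (X i - X j : MvPolynomial (Fin N) F) ≠ 0 :=
  sub_ne_zero.2 fun e => h (X_injective e)

lemma X_sub_X_dvd {N : ℕ} (i j : Fin N) (f : MvPolynomial (Fin N) F) :
    X i - X j ∣ f - Kswap i j f := by
  induction f using MvPolynomial.induction_on with
  | C a => simp [Kswap]
  | add p q hp hq =>
    have : p + q - Kswap i j (p + q) = (p - Kswap i j p) + (q - Kswap i j q) := by
      simp only [Kswap, map_add]; ring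
    rw [this]
    exact dvd_add hp hq
  | mul_X p k hp =>
    have : p * X k - Kswap i j (p * X k)
        = (p - Kswap i j p) * X k + Kswap i j p * (X k - X (Equiv.swap i j k)) := by
      simp only [Kswap, map_mul, rename_X]; ring
    rw [this]
    refine dvd_add (hp.mul_right _) (Dvd.dvd.mul_left ?_ _)
    rcases eq_or_ne k i with rfl | hi
    · simp
    rcases eq_or_ne k j with rfl | hj
    · rw [Equiv.swap_apply_right]
      exact ⟨-1, by ring⟩
    · simp [Equiv.swap_apply_of_ne_of_ne hi hj]

/-- The divided difference `(z_i - z_j)⁻¹ (1 - K_{ij})`. -/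
noncomputable def divDiff {N : ℕ} (i j : Fin N) (f : MvPolynomial (Fin N) F) :
    MvPolynomial (Fin N) F :=
  divExact (X i - X j) (f - Kswap i j f)

lemma sub_mul_divDiff {N : ℕ} (i j : Fin N) (f : MvPolynomial (Fin N) F) :
    (X i - X j) * divDiff i j f = f - Kswap i j f :=
  divExact_spec (X_sub_X_dvd i j f)

lemma divDiff_eq {N : ℕ} {i j : Fin N} (h : i ≠ j) {f c : MvPolynomial (Fin N) F}
    (hc : (X i - X j) * c = f - Kswap i j f) : divDiff i j f = c :=
  mul_left_cancel₀ (X_sub_X_ne_zero h) ((sub_mul_divDiff i j f).trans hc.symm)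

lemma divDiff_add {N : ℕ} {i j : Fin N} (h : i ≠ j) (f g : MvPolynomial (Fin N) F) :
    divDiff i j (f + g) = divDiff i j f + divDiff i j g :=
  divDiff_eq h <| by
    rw [mul_add, sub_mul_divDiff, sub_mul_divDiff]
    simp only [Kswap, map_add]
    ring

lemma divDiff_smul {N : ℕ} {i j : Fin N} (h : i ≠ j) (a : F) (f : MvPolynomial (Fin N) F) :
    divDiff i j (a • f) = a • divDiff i j f :=
  divDiff_eq h <| by
    rw [mul_smul_comm, sub_mul_divDiff]
    simp only [Kswap, map_smul, smul_sub]

lemma rename_Kswap {N : ℕ} (σ : Equiv.Perm (Fin N)) (i j : Fin N)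
    (f : MvPolynomial (Fin N) F) :
    rename σ (Kswap i j f) = Kswap (σ i) (σ j) (rename σ f) := by
  simp only [Kswap, rename_rename]
  congr 2
  funext k
  have := Equiv.swap_apply_apply σ i j
  simp [this]

lemma rename_divDiff {N : ℕ} (σ : Equiv.Perm (Fin N)) {i j : Fin N} (h : i ≠ j)
    (f : MvPolynomial (Fin N) F) :
    rename σ (divDiff i j f) = divDiff (σ i) (σ j) (rename σ f) := by
  refine (divDiff_eq (σ.injective.ne h) ?_).symm
  rw [← rename_Kswap, ← map_sub, ← sub_mul_divDiff, map_mul, map_sub, rename_X, rename_X]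

lemma divDiff_X_mul {N : ℕ} {i j : Fin N} (h : i ≠ j) (k : Fin N)
    (f : MvPolynomial (Fin N) F) :
    divDiff i j (X k * f) = X k * divDiff i j f
      + (if k = i then Kswap i j f else if k = j then - Kswap i j f else 0) := by
  refine divDiff_eq h ?_
  have e := sub_mul_divDiff i j f
  have e' : Kswap i j (X k * f) = X (Equiv.swap i j k) * Kswap i j f := by
    simp only [Kswap, map_mul, rename_X]
  rw [e', mul_add, mul_left_comm, e]
  split_ifs with h1 h2
  · subst h1; rw [Equiv.swap_apply_left]; ring
  · subst h2; rw [Equiv.swap_apply_right]; ring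
  · rw [Equiv.swap_apply_of_ne_of_ne h1 h2]; ring

lemma nabla_eq {N : ℕ} (β : F) (i : Fin N) (f : MvPolynomial (Fin N) F) :
    nabla β i f = pderiv i f + β • ∑ j ∈ Finset.univ.erase i, divDiff i j f := rfl

/-- The Dunkl operator `∇_i` as a linear map. -/
noncomputable def nablaL {N : ℕ} (β : F) (i : Fin N) : Module.End F (MvPolynomial (Fin N) F) where
  toFun := nabla β i
  map_add' f g := by
    simp only [nabla_eq]
    rw [Finset.sum_congr rfl fun j hj => divDiff_add (Finset.ne_of_mem_erase hj).symm f g,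
      Finset.sum_add_distrib, smul_add, map_add]
    abel
  map_smul' a f := by
    simp only [nabla_eq, RingHom.id_apply]
    rw [Finset.sum_congr rfl fun j hj => divDiff_smul (Finset.ne_of_mem_erase hj).symm a f,
      ← Finset.smul_sum, smul_comm, smul_add, Derivation.map_smul]

lemma nablaL_apply {N : ℕ} (β : F) (i : Fin N) (f : MvPolynomial (Fin N) F) :
    nablaL β i f = pderiv i f + β • ∑ j ∈ Finset.univ.erase i, divDiff i j f := rfl

lemma rename_nablaL {N : ℕ} (β : F) (σ : Equiv.Perm (Fin N)) (i : Fin N)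
    (f : MvPolynomial (Fin N) F) :
    rename σ (nablaL β i f) = nablaL β (σ i) (rename σ f) := by
  rw [nablaL_apply, nablaL_apply, map_add, map_smul, map_sum, pderiv_rename σ.injective]
  congr 2
  refine Finset.sum_bij (fun j _ => σ j) ?_ ?_ ?_ ?_
  · simp
  · simp
  · intro j hj
    exact ⟨σ.symm j, by simpa [Equiv.symm_apply_eq] using hj, by simp⟩
  · intro j hj
    exact rename_divDiff σ (Finset.ne_of_mem_erase hj).symm f

lemma Kswap_nablaL {N : ℕ} (β : F) (i j k : Fin N) (f : MvPolynomial (Fin N) F) :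
    Kswap i j (nablaL β k f) = nablaL β (Equiv.swap i j k) (Kswap i j f) :=
  rename_nablaL β _ k f

lemma nablaL_X_mul_of_ne {N : ℕ} (β : F) {i k : Fin N} (h : k ≠ i)
    (f : MvPolynomial (Fin N) F) :
    nablaL β i (X k * f) = X k * nablaL β i f - β • Kswap i k f := by
  rw [nablaL_apply, nablaL_apply,
    Finset.sum_congr rfl fun j hj => divDiff_X_mul (Finset.ne_of_mem_erase hj).symm k f,
    Finset.sum_add_distrib, ← Finset.mul_sum, Derivation.leibniz, pderiv_X_of_ne h]
  simp only [h, if_false, Finset.sum_ite_eq, Finset.mem_erase, Finset.mem_univ, ne_eq,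
    not_false_eq_true, and_self, if_true, smul_eq_mul, smul_add, smul_neg, mul_zero,
    add_zero, mul_add, mul_smul_comm]
  ring

lemma nablaL_X_mul_self {N : ℕ} (β : F) (i : Fin N) (f : MvPolynomial (Fin N) F) :
    nablaL β i (X i * f) = X i * nablaL β i f + f
      + β • ∑ l ∈ Finset.univ.erase i, Kswap i l f := by
  rw [nablaL_apply, nablaL_apply,
    Finset.sum_congr rfl fun j hj => divDiff_X_mul (Finset.ne_of_mem_erase hj).symm i f,
    Finset.sum_add_distrib, ← Finset.mul_sum, Derivation.leibniz, pderiv_X_self]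
  simp only [if_true, smul_eq_mul, smul_add, mul_add, mul_smul_comm, mul_one]
  ring

lemma nablaL_sum_Kswap {N : ℕ} (β : F) {i j : Fin N} (h : i ≠ j) (f : MvPolynomial (Fin N) F) :
    nablaL β j (∑ l ∈ Finset.univ.erase i, Kswap i l f)
      = ∑ l ∈ Finset.univ.erase i, Kswap i l (nablaL β j f)
        + Kswap i j (nablaL β i f) - Kswap i j (nablaL β j f) := by
  have hj : j ∈ Finset.univ.erase i := by simp [h.symm]
  rw [← Finset.add_sum_erase _ _ hj, ← Finset.add_sum_erase _ _ hj, map_add, map_sum,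
    Finset.sum_congr rfl fun l hl => ?_, Kswap_nablaL β i j i, Equiv.swap_apply_left]
  rotate_left
  · exact fun l => Kswap i l (nablaL β j f)
  · simp only [Finset.mem_erase] at hl
    rw [Kswap_nablaL, Equiv.swap_apply_of_ne_of_ne h.symm hl.1.symm]
  · ring

lemma nablaL_comm_X_mul {N : ℕ} (β : F) {i j : Fin N} (h : i ≠ j) (k : Fin N)
    (f : MvPolynomial (Fin N) F) (hf : nablaL β i (nablaL β j f) = nablaL β j (nablaL β i f)) :
    nablaL β i (nablaL β j (X k * f)) = nablaL β j (nablaL β i (X k * f)) := by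
  have key : ∀ {i j : Fin N}, i ≠ j →
      nablaL β i (nablaL β j f) = nablaL β j (nablaL β i f) →
      nablaL β i (nablaL β j (X i * f)) = nablaL β j (nablaL β i (X i * f)) := by
    intro i j h hf
    have hK' (g : MvPolynomial (Fin N) F) : Kswap j i g = Kswap i j g := by
      rw [Kswap, Equiv.swap_comm, Kswap]
    have e : Kswap i j (nablaL β j f) = nablaL β i (Kswap i j f) := by
      rw [Kswap_nablaL, Equiv.swap_apply_right]
    rw [nablaL_X_mul_of_ne β h, nablaL_X_mul_self, map_sub, map_add, map_add, map_smul, map_smul,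
      nablaL_X_mul_self, nablaL_X_mul_of_ne β h, nablaL_sum_Kswap β h, hf, hK', hK', ← e]
    simp only [smul_add, smul_sub]
    ring
  rcases eq_or_ne k i with rfl | hi
  · exact key h hf
  rcases eq_or_ne k j with rfl | hj
  · exact (key h.symm hf.symm).symm
  rw [nablaL_X_mul_of_ne β hj, nablaL_X_mul_of_ne β hi, map_sub, map_sub, map_smul, map_smul,
    nablaL_X_mul_of_ne β hj, nablaL_X_mul_of_ne β hi, hf, Kswap_nablaL, Kswap_nablaL,
    Equiv.swap_apply_of_ne_of_ne h hi.symm, Equiv.swap_apply_of_ne_of_ne h.symm hj.symm]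
  ring

lemma nablaL_C {N : ℕ} (β : F) (i : Fin N) (a : F) :
    nablaL β i (C a : MvPolynomial (Fin N) F) = 0 := by
  rw [nablaL_apply, pderiv_C, Finset.sum_eq_zero, smul_zero, add_zero]
  intro j hj
  exact divDiff_eq (Finset.ne_of_mem_erase hj).symm (by simp [Kswap])

/-- The Dunkl operators commute. -/
lemma nablaL_comm {N : ℕ} (β : F) (i j : Fin N) (f : MvPolynomial (Fin N) F) :
    nablaL β i (nablaL β j f) = nablaL β j (nablaL β i f) := by
  rcases eq_or_ne i j with rfl | h
  · rfl
  induction f using MvPolynomial.induction_on with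
  | C a => simp only [nablaL_C, map_zero]
  | add p q hp hq => simp only [map_add, hp, hq]
  | mul_X p k hp =>
    rw [mul_comm]
    exact nablaL_comm_X_mul β h k p hp

/-- `D_i` as a linear map. -/
noncomputable def DopL {N : ℕ} (β : F) (i : Fin N) : Module.End F (MvPolynomial (Fin N) F) :=
  LinearMap.mulLeft F (X i) * nablaL β i

/-- `K_{ij}` as a linear map. -/
noncomputable def KL {N : ℕ} (i j : Fin N) : Module.End F (MvPolynomial (Fin N) F) :=
  (rename (Equiv.swap i j)).toLinearMap

lemma DopL_apply {N : ℕ} (β : F) (i : Fin N) (f : MvPolynomial (Fin N) F) :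
    DopL β i f = X i * nablaL β i f := rfl

lemma KL_comm {N : ℕ} (i j : Fin N) :
    (KL i j : Module.End F (MvPolynomial (Fin N) F)) = KL j i := by
  rw [KL, Equiv.swap_comm, KL]

lemma KL_mul_DopL {N : ℕ} (β : F) (i j k : Fin N) :
    KL i j * DopL β k = DopL β (Equiv.swap i j k) * KL i j := by
  refine LinearMap.ext fun f => ?_
  change rename (Equiv.swap i j) (X k * nablaL β k f) = X _ * nablaL β _ (rename (Equiv.swap i j) f)
  rw [map_mul, rename_X, rename_nablaL]

lemma KL_mul_DopL_of_ne {N : ℕ} (β : F) {i j k : Fin N} (hi : k ≠ i) (hj : k ≠ j) :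
    KL i j * DopL β k = DopL β k * KL i j := by
  rw [KL_mul_DopL, Equiv.swap_apply_of_ne_of_ne hi hj]

lemma KL_mul_KL {N : ℕ} (i j k l : Fin N) :
    (KL i j * KL k l : Module.End F (MvPolynomial (Fin N) F))
      = KL (Equiv.swap i j k) (Equiv.swap i j l) * KL i j :=
  LinearMap.ext fun f => rename_Kswap (Equiv.swap i j) k l f

lemma DopL_mul_DopL {N : ℕ} (β : F) {i j : Fin N} (h : i ≠ j) :
    DopL β i * DopL β j = DopL β j * DopL β i + β • ((DopL β j - DopL β i) * KL i j) := by
  have aux : ∀ {i j : Fin N}, i ≠ j → ∀ f, DopL β i (DopL β j f)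
      = X i * X j * nablaL β i (nablaL β j f) - β • DopL β i (KL i j f) := by
    intro i j h f
    have e : nablaL β i (KL i j f) = Kswap i j (nablaL β j f) := by
      rw [Kswap_nablaL, Equiv.swap_apply_right]; rfl
    rw [DopL_apply, DopL_apply, DopL_apply, nablaL_X_mul_of_ne β h.symm, e, mul_sub,
      mul_smul_comm, mul_assoc]
  refine LinearMap.ext fun f => ?_
  simp only [Module.End.mul_apply, LinearMap.add_apply, LinearMap.smul_apply, LinearMap.sub_apply]
  rw [aux h, aux h.symm, KL_comm j i, nablaL_comm β j i, smul_sub]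
  ring

end DunklRelations

section CherednikOperators

variable {F : Type*} [Field F]

/-- The Cherednik operator `D_n + β ∑_{i < n} K_{in}`. -/
noncomputable def cherednik {N : ℕ} (β : F) (n : Fin N) : Module.End F (MvPolynomial (Fin N) F) :=
  DopL β n + β • ∑ i ∈ Finset.Iio n, KL i n

lemma commute_cherednik_DopL {N : ℕ} (β : F) {j n : Fin N} (h : j < n) :
    Commute (cherednik β n) (DopL β j) := by
  have hj : j ∈ Finset.Iio n := Finset.mem_Iio.2 h
  have hs : (∑ i ∈ Finset.Iio n, KL i n) * DopL β j
      = DopL β j * (∑ i ∈ Finset.Iio n, KL i n) + (DopL β n - DopL β j) * KL j n := by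
    rw [← Finset.add_sum_erase _ _ hj, add_mul, mul_add, KL_mul_DopL, Equiv.swap_apply_left,
      Finset.sum_mul, Finset.mul_sum, sub_mul,
      Finset.sum_congr rfl fun i hi =>
        KL_mul_DopL_of_ne β (Finset.ne_of_mem_erase hi).symm h.ne]
    abel
  rw [Commute, SemiconjBy, cherednik, add_mul, mul_add, smul_mul_assoc, mul_smul_comm, hs,
    DopL_mul_DopL β h.ne', KL_comm n j, smul_add, sub_mul, sub_mul, smul_sub, smul_sub]
  abel

lemma commute_cherednik_KL {N : ℕ} (β : F) {i j n : Fin N} (hi : i < n) (hj : j < n) :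
    Commute (cherednik β n) (KL i j) := by
  have hn : Equiv.swap i j n = n := Equiv.swap_apply_of_ne_of_ne hi.ne' hj.ne'
  have hs : KL i j * (∑ k ∈ Finset.Iio n, KL k n)
      = (∑ k ∈ Finset.Iio n, KL k n) * (KL i j : Module.End F (MvPolynomial (Fin N) F)) := by
    rw [Finset.mul_sum, Finset.sum_mul]
    have hmem : ∀ k ∈ Finset.Iio n, Equiv.swap i j k ∈ Finset.Iio n := by
      intro k hk
      rcases eq_or_ne k i with rfl | h1
      · simpa using hj
      rcases eq_or_ne k j with rfl | h2
      · simpa using hi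
      rwa [Equiv.swap_apply_of_ne_of_ne h1 h2]
    refine Finset.sum_bij' (fun k _ => Equiv.swap i j k) (fun k _ => Equiv.swap i j k)
      hmem hmem (by simp) (by simp) fun k _ => ?_
    rw [KL_mul_KL, hn]
  rw [Commute, SemiconjBy, cherednik, add_mul, mul_add, smul_mul_assoc, mul_smul_comm, hs,
    KL_mul_DopL, hn]

lemma commute_cherednik {N : ℕ} (β : F) (m n : Fin N) :
    Commute (cherednik β m) (cherednik β n) := by
  wlog h : n < m generalizing m n
  · rcases (not_lt.1 h).eq_or_lt with rfl | h'
    · exact Commute.refl _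
    · exact (this n m h').symm
  rw [cherednik.eq_1 β n]
  refine (commute_cherednik_DopL β h).add_right (Commute.smul_right ?_ _)
  exact Commute.sum_right _ _ _ fun i hi =>
    commute_cherednik_KL β ((Finset.mem_Iio.1 hi).trans h) h

/-- The polynomial in the Cherednik operators agreeing with `D_n^r` on symmetric polynomials. -/
noncomputable def powOp {N : ℕ} (β : F) : ℕ → Fin N → Module.End F (MvPolynomial (Fin N) F)
  | 0, _ => 1
  | r + 1, n => cherednik β n * powOp β r n - β • ∑ i ∈ Finset.Iio n, powOp β r i

lemma commute_cherednik_powOp {N : ℕ} (β : F) (m : Fin N) (r : ℕ) (n : Fin N) :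
    Commute (cherednik β m) (powOp β r n) := by
  induction r generalizing n with
  | zero => exact Commute.one_right _
  | succ r ih =>
    exact ((commute_cherednik β m n).mul_right (ih n)).sub_right
      ((Commute.sum_right _ _ _ fun i _ => ih i).smul_right _)

lemma KL_DopL_pow {N : ℕ} (β : F) (i j k : Fin N) (r : ℕ) (f : MvPolynomial (Fin N) F) :
    KL i j ((DopL β k ^ r) f) = (DopL β (Equiv.swap i j k) ^ r) (KL i j f) := by
  have h : SemiconjBy (KL i j) (DopL β k) (DopL β (Equiv.swap i j k)) := KL_mul_DopL β i j k
  exact LinearMap.congr_fun (h.pow_right r) f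

lemma KL_DopL_pow_of_ne {N : ℕ} (β : F) {i j k : Fin N} (hi : k ≠ i) (hj : k ≠ j) (r : ℕ)
    (f : MvPolynomial (Fin N) F) :
    KL i j ((DopL β k ^ r) f) = (DopL β k ^ r) (KL i j f) := by
  rw [KL_DopL_pow, Equiv.swap_apply_of_ne_of_ne hi hj]

/-- On symmetric polynomials, `Y_n D_n^r = D_n^{r+1} + β ∑_{i < n} D_i^r`. -/
lemma cherednik_DopL_pow {N : ℕ} (β : F) {f : MvPolynomial (Fin N) F}
    (hf : ∀ i j, KL i j f = f) (r : ℕ) (n : Fin N) :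
    cherednik β n ((DopL β n ^ r) f)
      = (DopL β n ^ (r + 1)) f + β • ∑ i ∈ Finset.Iio n, (DopL β i ^ r) f := by
  simp only [cherednik, LinearMap.add_apply, LinearMap.smul_apply, LinearMap.sum_apply,
    pow_succ' _ r, Module.End.mul_apply, KL_DopL_pow, Equiv.swap_apply_right, hf]

lemma DopL_pow_eq_powOp {N : ℕ} (β : F) {f : MvPolynomial (Fin N) F}
    (hf : ∀ i j, KL i j f = f) (r : ℕ) (n : Fin N) :
    (DopL β n ^ r) f = powOp β r n f := by
  induction r generalizing n with
  | zero => rfl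
  | succ r ih =>
    simp only [powOp, LinearMap.sub_apply, LinearMap.smul_apply, LinearMap.sum_apply,
      Module.End.mul_apply, ← ih, cherednik_DopL_pow β hf, add_sub_cancel_right]

/-- The operator product along a list, `(D_{j₁} + kβ)(D_{j₂} + (k+1)β) ⋯`, as a linear map. -/
noncomputable def DlistL {N : ℕ} (β : F) :
    ℕ → List (Fin N) → Module.End F (MvPolynomial (Fin N) F)
  | _, [] => 1
  | k, j :: l => (DopL β j + ((k : F) * β) • 1) * DlistL β (k + 1) l

lemma DlistL_apply {N : ℕ} (β : F) (k : ℕ) (l : List (Fin N)) (f : MvPolynomial (Fin N) F) :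
    DlistL β k l f = Dlist β k l f := by
  induction l generalizing k with
  | nil => rfl
  | cons j l ih =>
    rw [Dlist, ← ih]
    rfl

lemma DlistL_append_singleton {N : ℕ} (β : F) (k : ℕ) (l : List (Fin N)) (n : Fin N) :
    DlistL β k (l ++ [n])
      = DlistL β k l * (DopL β n + (((k + l.length : ℕ) : F) * β) • 1) := by
  induction l generalizing k with
  | nil => simp [DlistL]
  | cons j l ih =>
    rw [List.cons_append, DlistL, ih, DlistL, mul_assoc, List.length_cons]
    congr 6
    omega

lemma commute_KL_DlistL {N : ℕ} (β : F) {i j : Fin N} {l : List (Fin N)} (hi : i ∉ l)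
    (hj : j ∉ l) (k : ℕ) : Commute (KL i j) (DlistL β k l) := by
  induction l generalizing k with
  | nil => exact Commute.one_right _
  | cons a l ih =>
    simp only [List.mem_cons, not_or] at hi hj
    refine Commute.mul_right (Commute.add_right ?_ ?_) (ih hi.2 hj.2 _)
    · exact KL_mul_DopL_of_ne β (Ne.symm hi.1) (Ne.symm hj.1)
    · exact (Commute.one_right _).smul_right _

lemma KL_mul_DopL_mul_DopL {N : ℕ} (β : F) {a b : Fin N} (hab : a ≠ b) (c : F)
    {h : MvPolynomial (Fin N) F} (hh : KL a b h = h) :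
    KL a b (((DopL β a + c • 1) * (DopL β b + (c + β) • 1)) h)
      = ((DopL β a + c • 1) * (DopL β b + (c + β) • 1)) h := by
  have h1 (g : MvPolynomial (Fin N) F) : KL a b (DopL β a g) = DopL β b (KL a b g) := by
    simpa using KL_DopL_pow β a b a 1 g
  have h2 (g : MvPolynomial (Fin N) F) : KL a b (DopL β b g) = DopL β a (KL a b g) := by
    simpa using KL_DopL_pow β a b b 1 g
  have h3 := LinearMap.congr_fun (DopL_mul_DopL β hab) h
  simp only [Module.End.mul_apply, LinearMap.add_apply, LinearMap.smul_apply,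
    LinearMap.sub_apply, hh] at h3
  simp only [Module.End.mul_apply, LinearMap.add_apply, LinearMap.smul_apply,
    Module.End.one_apply, map_add, map_sub, map_smul, h1, h2, hh, h3]
  module

/-- The ordered product `D_{k,J}` preserves invariance under the exchanges within `J`. -/
lemma KL_DlistL {N : ℕ} (β : F) {l : List (Fin N)} (hl : l.Nodup)
    {h : MvPolynomial (Fin N) F} (hh : ∀ i ∈ l, ∀ j ∈ l, KL i j h = h) (k : ℕ) :
    ∀ i ∈ l, ∀ j ∈ l, KL i j (DlistL β k l h) = DlistL β k l h := by
  have hrefl (i : Fin N) (g : MvPolynomial (Fin N) F) : KL i i g = g := by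
    simp [KL]
  induction l generalizing k with
  | nil => simp
  | cons a l ih =>
    have hal : a ∉ l := (List.nodup_cons.1 hl).1
    have htail := ih (List.nodup_cons.1 hl).2
      (fun i hi j hj => hh i (.tail _ hi) j (.tail _ hj)) (k + 1)
    have hll : ∀ i ∈ l, ∀ j ∈ l, KL i j (DlistL β k (a :: l) h) = DlistL β k (a :: l) h := by
      intro i hi j hj
      have hc : Commute (KL i j) (DopL β a + ((k : F) * β) • 1) := by
        refine Commute.add_right ?_ ((Commute.one_right _).smul_right _)
        exact KL_mul_DopL_of_ne β (ne_of_mem_of_not_mem hi hal).symm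
          (ne_of_mem_of_not_mem hj hal).symm
      have := LinearMap.congr_fun hc.eq (DlistL β (k + 1) l h)
      simp only [Module.End.mul_apply, htail i hi j hj] at this
      exact this
    have hahead : ∀ j ∈ l, KL a j (DlistL β k (a :: l) h) = DlistL β k (a :: l) h := by
      cases l with
      | nil => simp
      | cons b l =>
        have hab : a ≠ b := fun e => hal (e ▸ .head _)
        have hbl : b ∉ l := (List.nodup_cons.1 (List.nodup_cons.1 hl).2).1
        have hb : KL a b (DlistL β k (a :: b :: l) h) = DlistL β k (a :: b :: l) h := by
          have hc : KL a b (DlistL β (k + 1 + 1) l h) = DlistL β (k + 1 + 1) l h := by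
            have := LinearMap.congr_fun
              (commute_KL_DlistL β (fun h => hal (.tail _ h)) hbl (k + 1 + 1)).eq h
            simpa only [Module.End.mul_apply, hh a (.head _) b (.tail _ (.head _))] using this
          have := KL_mul_DopL_mul_DopL β hab ((k : F) * β) hc
          have e : (k : F) * β + β = ((k + 1 : ℕ) : F) * β := by push_cast; ring
          rwa [e] at this
        intro j hj
        rcases eq_or_ne j b with rfl | hjb
        · exact hb
        have hja : j ≠ a := ne_of_mem_of_not_mem hj hal
        have e := LinearMap.congr_fun (KL_mul_KL (F := F) b j a b) (DlistL β k (a :: b :: l) h)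
        rw [Equiv.swap_apply_of_ne_of_ne hab hja.symm, Equiv.swap_apply_left] at e
        simp only [Module.End.mul_apply, hb, hll b (.head _) j hj] at e
        exact e.symm
    intro i hi j hj
    rcases List.mem_cons.1 hi with rfl | hi'
    · rcases List.mem_cons.1 hj with rfl | hj'
      · exact hrefl _ _
      · exact hahead j hj'
    · rcases List.mem_cons.1 hj with rfl | hj'
      · rw [KL_comm]
        exact hahead i hi'
      · exact hll i hi' j hj'

/-- The product of the operators `Y_j + β` along a list. -/
noncomputable def cherednikProd {N : ℕ} (β : F) (l : List (Fin N)) :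
    Module.End F (MvPolynomial (Fin N) F) :=
  (l.map fun j => cherednik β j + β • 1).prod

lemma commute_cherednikProd_powOp {N : ℕ} (β : F) (l : List (Fin N)) (r : ℕ) (n : Fin N) :
    Commute (powOp β r n) (cherednikProd β l) := by
  refine Commute.list_prod_right _ _ fun x hx => ?_
  obtain ⟨j, -, rfl⟩ := List.mem_map.1 hx
  exact ((commute_cherednik_powOp β j r n).add_left
    ((Commute.one_left _).smul_left _)).symm

/-- Along a list of consecutive indices, `D_{k,J}` is the product of the `Y_j + β`. -/
lemma DlistL_eq_cherednikProd {N : ℕ} (β : F) {m : ℕ} {l : List (Fin N)}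
    (hl : l.map Fin.val = List.range' m l.length) {h : MvPolynomial (Fin N) F}
    (hh : ∀ j ∈ l, ∀ i < j, KL i j h = h) :
    DlistL β (m + 1) l h = cherednikProd β l h := by
  induction l generalizing m with
  | nil => rfl
  | cons a l ih =>
    simp only [List.map_cons, List.length_cons, List.range'_succ, List.cons.injEq] at hl
    obtain ⟨rfl, hl⟩ := hl
    have hlt : ∀ j ∈ l, a < j := by
      intro j hj
      have : (j : ℕ) ∈ l.map Fin.val := List.mem_map_of_mem hj
      rw [hl, List.mem_range'_1] at this
      exact Fin.lt_def.2 this.1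
    have hK : ∀ i < a, KL i a (DlistL β ((a : ℕ) + 1 + 1) l h)
        = DlistL β ((a : ℕ) + 1 + 1) l h := by
      intro i hi
      have := LinearMap.congr_fun (commute_KL_DlistL β (fun h => (hi.trans (hlt i h)).false)
        (fun h => (hlt a h).false) ((a : ℕ) + 1 + 1)).eq h
      simpa only [Module.End.mul_apply, hh a (.head _) i hi] using this
    have hi := ih hl fun j hj => hh j (.tail _ hj)
    rw [cherednikProd, List.map_cons, List.prod_cons, Module.End.mul_apply, ← cherednikProd, ← hi,
      DlistL, Module.End.mul_apply]
    simp only [cherednik, LinearMap.add_apply, LinearMap.smul_apply, LinearMap.sum_apply,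
      Module.End.one_apply]
    rw [Finset.sum_congr rfl fun i hi => hK i (Finset.mem_Iio.1 hi), Finset.sum_const,
      Fin.card_Iio, ← Nat.cast_smul_eq_nsmul F]
    push_cast
    module

end CherednikOperators

lemma map_val_sort_filter_lt {N : ℕ} (m : ℕ) (hm : m ≤ N) :
    ((Finset.univ.filter (fun x : Fin N => (x : ℕ) < m)).sort (· ≤ ·)).map Fin.val
      = List.range m := by
  refine List.SortedLT.eq_of_mem_iff ?_ (List.sortedLT_range m) fun x => ?_
  · exact Fin.val_strictMono.sortedLT_listMap.2 (Finset.sortedLT_sort _)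
  · simp only [List.mem_map, Finset.mem_sort, Finset.mem_filter, Finset.mem_univ, true_and,
      List.mem_range]
    exact ⟨by rintro ⟨y, hy, rfl⟩; exact hy, fun hx => ⟨⟨x, hx.trans_le hm⟩, hx, rfl⟩⟩

/-- for `N ≥ 2`, `r ≥ 0` and symmetric `f`,
`[D_N^r, D_{1,{1,…,N}}] f = β D_{1,{1,…,N-1}} (∑_{i=1}^{N-1} D_i^r - (N-1) D_N^r) f`.
(0-indexed: `D_N` is `Dop β ⟨N-1,_⟩`, `{1,…,N-1}` is `{x | x < N-1}`.) -/
theorem statement_15 {F : Type*} [Field F] [CharZero F] {N : ℕ} (hN : 2 ≤ N) (β : F)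
    (r : ℕ) (f : MvPolynomial (Fin N) F) (hf : f.IsSymmetric) :
    (Dop β (⟨N - 1, by omega⟩ : Fin N))^[r] (DJ β 1 Finset.univ f)
      - DJ β 1 Finset.univ ((Dop β (⟨N - 1, by omega⟩ : Fin N))^[r] f)
    = β • DJ β 1 (Finset.univ.filter (fun x : Fin N => (x : ℕ) < N - 1))
        ((∑ i ∈ Finset.univ.filter (fun x : Fin N => (x : ℕ) < N - 1), (Dop β i)^[r] f)
          - ((N - 1 : ℕ) : F) • (Dop β (⟨N - 1, by omega⟩ : Fin N))^[r] f) := by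
  obtain ⟨n, rfl⟩ : ∃ n, N = n + 1 := ⟨N - 1, by omega⟩
  simp only [Nat.add_sub_cancel]
  set p : Fin (n + 1) := ⟨n, by omega⟩ with hp
  set S := Finset.univ.filter (fun x : Fin (n + 1) => (x : ℕ) < n) with hS
  have hSp : S = Finset.Iio p := by ext x; simp [hS, hp, Fin.lt_def]
  set l := S.sort (· ≤ ·) with hl
  have hlval : l.map Fin.val = List.range n := map_val_sort_filter_lt n (by omega)
  have hlen : l.length = n := by simpa using congrArg List.length hlval
  have huniv : Finset.univ.sort (· ≤ ·) = l ++ [p] := by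
    apply List.map_injective_iff.2 Fin.val_injective
    rw [List.map_append, hlval, Fin.sort_univ, List.map_coe_finRange_eq_range, List.range_succ]
    rfl
  have hltp : ∀ i ∈ l, i < p := fun i hi => by
    rw [hl, Finset.mem_sort, hSp] at hi
    exact Finset.mem_Iio.1 hi
  have hpow (i : Fin (n + 1)) (g : MvPolynomial (Fin (n + 1)) F) :
      (Dop β i)^[r] g = (DopL β i ^ r) g := (Module.End.pow_apply (DopL β i) r g).symm
  have hK : ∀ i j, KL i j f = f := fun i j => hf _
  have hprod : DlistL β 1 (l ++ [p]) f = cherednikProd β (l ++ [p]) f := by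
    refine DlistL_eq_cherednikProd (m := 0) β ?_ fun j _ i _ => hK i j
    rw [List.map_append, hlval, List.length_append, hlen, ← List.range_eq_range',
      List.length_singleton, List.range_succ]
    rfl
  have hsymm : ∀ i j, KL i j (DlistL β 1 (l ++ [p]) f) = DlistL β 1 (l ++ [p]) f := by
    rw [← huniv]
    intro i j
    exact KL_DlistL β (Finset.sort_nodup _ _) (fun i _ j _ => hK i j) 1 i (by simp) j (by simp)
  have hcons : ∀ g, (∀ i < p, ∀ j < p, KL i j g = g) → cherednikProd β l g = DlistL β 1 l g := by
    intro g hg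
    refine (DlistL_eq_cherednikProd (m := 0) β ?_ fun j hj i hi => ?_).symm
    · rw [hlval, hlen, List.range_eq_range']
    · exact hg i (hi.trans (hltp j hj)) j (hltp j hj)
  have hinv : ∀ i < p, ∀ j < p, KL i j ((cherednik β p + β • 1) ((DopL β p ^ r) f))
      = (cherednik β p + β • 1) ((DopL β p ^ r) f) := by
    intro i hi j hj
    have hc : Commute (cherednik β p + β • 1) (KL i j) :=
      (commute_cherednik_KL β hi hj).add_left ((Commute.one_left _).smul_left _)
    have := LinearMap.congr_fun hc.eq ((DopL β p ^ r) f)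
    simpa only [Module.End.mul_apply, KL_DopL_pow_of_ne β hi.ne' hj.ne', hK] using this.symm
  have hmain : (DopL β p ^ r) (DlistL β 1 (l ++ [p]) f)
      = DlistL β 1 l ((DopL β p ^ (r + 1)) f + β • ∑ i ∈ S, (DopL β i ^ r) f
        + β • (DopL β p ^ r) f) := by
    have e := LinearMap.congr_fun (commute_cherednikProd_powOp β (l ++ [p]) r p).eq f
    simp only [Module.End.mul_apply] at e
    rw [DopL_pow_eq_powOp β hsymm, hprod, e, ← DopL_pow_eq_powOp β hK, cherednikProd,
      List.map_append, List.prod_append, Module.End.mul_apply, ← cherednikProd, List.map_singleton,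
      List.prod_singleton, hcons _ hinv, LinearMap.add_apply, cherednik_DopL_pow β hK, hSp]
    rfl
  simp only [hpow, DJ, huniv, ← hl, ← DlistL_apply]
  rw [hmain, DlistL_append_singleton, Module.End.mul_apply, ← map_sub, ← map_smul (DlistL β 1 l), hlen,
    pow_succ' _ r]
  congr 1
  simp only [Module.End.mul_apply, LinearMap.add_apply, LinearMap.smul_apply,
    Module.End.one_apply]
  push_cast
  module
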